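/- arXiv:1709.07975 — 2 statements merged into one kernel-verified Lean document; each statement's English description precedes it below -/
import Mathlib

section
/- Let a and b be vertices of a finite simple graph X with adjacency matrix A such that a and b are parallel and have the same eigenvalue support. If Q is any real V×V matrix that commutes with A and satisfies Q e_a = e_a, then Q e_b = e_b. -/
open Matrix BigOperators

/-- A spectral decomposition of a real symmetric matrix `A`: the `θ r` are the distinct
eigenvalues and `E r` is the orthogonal projection onto the `θ r`-eigenspace. -/
structure IsSpectralDecomp {V : Type*} [Fintype V] [DecidableEq V] (A : Matrix V V ℝ)
    {m : ℕ} (θ : Fin m → ℝ) (E : Fin m → Matrix V V ℝ) : Prop where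
  theta_inj : Function.Injective θ
  symm : ∀ r, (E r)ᵀ = E r
  idem : ∀ r, E r * E r = E r
  mul_eq_zero : ∀ r s, r ≠ s → E r * E s = 0
  sum_eq_one : ∑ r, E r = 1
  eq_sum : A = ∑ r, θ r • E r
  ne_zero : ∀ r, E r ≠ 0

namespace IsSpectralDecomp

variable {V : Type*} [Fintype V] [DecidableEq V] {A : Matrix V V ℝ} {m : ℕ} {θ : Fin m → ℝ}
  {E : Fin m → Matrix V V ℝ}

theorem mul_idempotent (h : IsSpectralDecomp A θ E) (r : Fin m) : A * E r = θ r • E r := by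
  rw [h.eq_sum, Finset.sum_mul, Finset.sum_eq_single r]
  · rw [smul_mul_assoc, h.idem]
  · intro s _ hs
    rw [smul_mul_assoc, h.mul_eq_zero s r hs, smul_zero]
  · simp

theorem idempotent_mul (h : IsSpectralDecomp A θ E) (r : Fin m) : E r * A = θ r • E r := by
  rw [h.eq_sum, Finset.mul_sum, Finset.sum_eq_single r]
  · rw [mul_smul_comm, h.idem]
  · intro s _ hs
    rw [mul_smul_comm, h.mul_eq_zero r s hs.symm, smul_zero]
  · simp

theorem idempotent_mul_mul_idempotent_eq_zero (h : IsSpectralDecomp A θ E) {Q : Matrix V V ℝ}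
    (hQ : Q * A = A * Q) {r s : Fin m} (hrs : r ≠ s) : E r * Q * E s = 0 := by
  have key : θ s • (E r * Q * E s) = θ r • (E r * Q * E s) := by
    calc θ s • (E r * Q * E s) = E r * (Q * A) * E s := by
          rw [← mul_smul_comm, ← h.mul_idempotent]
          simp only [mul_assoc]
      _ = θ r • (E r * Q * E s) := by
          rw [hQ, ← mul_assoc, h.idempotent_mul, smul_mul_assoc, smul_mul_assoc]
  by_contra hne
  exact hrs (h.theta_inj (smul_left_injective ℝ hne key)).symm

/-- A matrix commuting with `A` commutes with its spectral idempotents. -/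
theorem commute_idempotent (h : IsSpectralDecomp A θ E) {Q : Matrix V V ℝ}
    (hQ : Q * A = A * Q) (r : Fin m) : Q * E r = E r * Q := by
  have hl : Q * E r = E r * Q * E r := by
    calc Q * E r = ∑ s, E s * Q * E r := by
          rw [← Finset.sum_mul, ← Finset.sum_mul, h.sum_eq_one, one_mul]
      _ = E r * Q * E r := Finset.sum_eq_single r
          (fun s _ hs => h.idempotent_mul_mul_idempotent_eq_zero hQ hs) (by simp)
  have hr : E r * Q = E r * Q * E r := by
    calc E r * Q = ∑ s, E r * Q * E s := by
          rw [← Finset.mul_sum, h.sum_eq_one, mul_one]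
      _ = E r * Q * E r := Finset.sum_eq_single r
          (fun s _ hs => h.idempotent_mul_mul_idempotent_eq_zero hQ hs.symm) (by simp)
  rw [hl, ← hr]

end IsSpectralDecomp

/-- If `a` and `b` are parallel with the same eigenvalue support and `Q` commutes with
the adjacency matrix and fixes `e_a`, then `Q` fixes `e_b`. -/
theorem fixes_of_parallel_same_support {V : Type*} [Fintype V] [DecidableEq V]
    (X : SimpleGraph V) [DecidableRel X.Adj] {m : ℕ} (θ : Fin m → ℝ)
    (E : Fin m → Matrix V V ℝ) (hdec : IsSpectralDecomp (X.adjMatrix ℝ) θ E) (a b : V)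
    (hpar : ∀ r,
      (∃ c : ℝ, E r *ᵥ Pi.single a 1 = c • (E r *ᵥ Pi.single b 1)) ∨
      (∃ c : ℝ, E r *ᵥ Pi.single b 1 = c • (E r *ᵥ Pi.single a 1)))
    (hsupp : ∀ r, E r *ᵥ Pi.single a 1 ≠ 0 ↔ E r *ᵥ Pi.single b 1 ≠ 0)
    (Q : Matrix V V ℝ) (hQA : Q * X.adjMatrix ℝ = X.adjMatrix ℝ * Q)
    (hQa : Q *ᵥ Pi.single a 1 = Pi.single a 1) :
    Q *ᵥ Pi.single b 1 = Pi.single b 1 := by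
  have hspan : ∀ r, ∃ c : ℝ, E r *ᵥ Pi.single b 1 = c • (E r *ᵥ Pi.single a 1) := by
    intro r
    rcases hpar r with ⟨c, hc⟩ | h
    · by_cases hc0 : c = 0
      · have hb : E r *ᵥ Pi.single b 1 = 0 := by
          by_contra hb
          exact (hsupp r).mpr hb (by rw [hc, hc0, zero_smul])
        exact ⟨0, by rw [hb, zero_smul]⟩
      · exact ⟨c⁻¹, by rw [hc, inv_smul_smul₀ hc0]⟩
    · exact h
  have hfix : ∀ r, Q *ᵥ (E r *ᵥ Pi.single b 1) = E r *ᵥ Pi.single b 1 := by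
    intro r
    obtain ⟨c, hc⟩ := hspan r
    rw [hc, mulVec_smul, mulVec_mulVec, hdec.commute_idempotent hQA, ← mulVec_mulVec, hQa]
  have hsum : (Pi.single b 1 : V → ℝ) = ∑ r, E r *ᵥ Pi.single b 1 := by
    rw [← sum_mulVec, hdec.sum_eq_one, one_mulVec]
  rw [hsum, mulVec_sum]
  exact Finset.sum_congr rfl fun r _ => hfix r
end

section
/- Let a and b be vertices of a finite simple graph X on n vertices with adjacency matrix A having distinct eigenvalues θ_1,…,θ_m and spectral idempotents E_1,…,E_m. If a and b are not cospectral, then max over r of |(E_r)_{a,a} − (E_r)_{b,b}| is at least 1/T, where T = Σ_{r=1}^m Σ_{ℓ=0}^{n−1} θ_r^{2ℓ} (T = trace(FF^T) for the m×n matrix F with F_{r,ℓ} = θ_r^{ℓ−1}). -/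
open Matrix BigOperators

namespace IsSpectralDecomp

variable {V : Type*} [Fintype V] [DecidableEq V] {A : Matrix V V ℝ} {m : ℕ} {θ : Fin m → ℝ}
  {E : Fin m → Matrix V V ℝ}

theorem sum_smul_mul_sum_smul (h : IsSpectralDecomp A θ E) (f g : Fin m → ℝ) :
    (∑ r, f r • E r) * ∑ r, g r • E r = ∑ r, (f r * g r) • E r := by
  rw [Finset.sum_mul]
  refine Finset.sum_congr rfl fun r _ => ?_
  rw [Finset.mul_sum, Finset.sum_eq_single r]
  · rw [smul_mul_smul_comm, h.idem]
  · intro s _ hs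
    rw [smul_mul_smul_comm, h.mul_eq_zero r s hs.symm, smul_zero]
  · simp

theorem pow_eq_sum (h : IsSpectralDecomp A θ E) (k : ℕ) : A ^ k = ∑ r, θ r ^ k • E r := by
  induction k with
  | zero => simp [h.sum_eq_one]
  | succ k ih =>
    conv_lhs => rw [pow_succ, ih, h.eq_sum]
    simp only [h.sum_smul_mul_sum_smul, pow_succ]

theorem aeval_eq_sum (h : IsSpectralDecomp A θ E) (p : Polynomial ℝ) :
    Polynomial.aeval A p = ∑ r, p.eval (θ r) • E r := by
  induction p using Polynomial.induction_on' with
  | add p q hp hq => simp [hp, hq, add_smul, Finset.sum_add_distrib]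
  | monomial k c =>
    simp [Polynomial.aeval_monomial, h.pow_eq_sum, Algebra.algebraMap_eq_smul_one,
      Finset.smul_sum, smul_smul]

/-- Every spectral idempotent is a polynomial in the matrix. -/
theorem exists_aeval_eq (h : IsSpectralDecomp A θ E) (r : Fin m) :
    ∃ p : Polynomial ℝ, Polynomial.aeval A p = E r := by
  refine ⟨Lagrange.basis Finset.univ θ r, ?_⟩
  rw [h.aeval_eq_sum, Finset.sum_eq_single r]
  · rw [Lagrange.eval_basis_self h.theta_inj.injOn (Finset.mem_univ r), one_smul]
  · intro s _ hs
    rw [Lagrange.eval_basis_of_ne hs.symm (Finset.mem_univ s), zero_smul]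
  · simp

/-- The resolvent identity in terms of the adjugate. -/
theorem adjugate_scalar_sub (h : IsSpectralDecomp A θ E) {t : ℝ} (ht : t ∉ Set.range θ) :
    (scalar V t - A).adjugate = (scalar V t - A).det • ∑ r, (t - θ r)⁻¹ • E r := by
  have hM : scalar V t - A = ∑ r, (t - θ r) • E r := by
    simp only [sub_smul, Finset.sum_sub_distrib, ← Finset.smul_sum, h.sum_eq_one, ← h.eq_sum]
    rw [scalar_apply, smul_one_eq_diagonal]
  have hinv : (scalar V t - A) * ∑ r, (t - θ r)⁻¹ • E r = 1 := by
    rw [hM, h.sum_smul_mul_sum_smul, ← h.sum_eq_one]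
    refine Finset.sum_congr rfl fun r _ => ?_
    rw [mul_inv_cancel₀ (sub_ne_zero.2 fun hr => ht ⟨r, hr.symm⟩), one_smul]
  rw [← Matrix.mul_one (scalar V t - A).adjugate, ← hinv, ← Matrix.mul_assoc, adjugate_mul,
    smul_mul, Matrix.one_mul]

end IsSpectralDecomp

namespace Matrix

variable {V : Type*} [Fintype V] [DecidableEq V]

theorem adjugate_apply_self {R : Type*} [CommRing R] (M : Matrix V V R) (a : V) :
    M.adjugate a a = (M.submatrix (fun i : {x : V // x ≠ a} => (i : V))
      (fun i : {x : V // x ≠ a} => (i : V))).det := by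
  rw [adjugate_apply, twoBlockTriangular_det _ (fun i => i ≠ a)]
  · have hone : toSquareBlockProp (M.updateRow a (Pi.single a 1)) (fun i => ¬ i ≠ a) = 1 := by
      ext ⟨i, hi⟩ ⟨j, hj⟩
      obtain rfl := not_ne_iff.1 hi
      obtain rfl := not_ne_iff.1 hj
      simp [toSquareBlockProp]
    have hrest : toSquareBlockProp (M.updateRow a (Pi.single a 1)) (fun i => i ≠ a) =
        M.submatrix (fun i : {x : V // x ≠ a} => (i : V))
          (fun i : {x : V // x ≠ a} => (i : V)) := by
      ext i j
      simp [toSquareBlockProp, updateRow_ne i.2]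
    rw [hone, hrest, det_one, mul_one]
  · intro i hi j hj
    obtain rfl := not_ne_iff.1 hi
    simp [hj]

theorem eval_charpoly_submatrix_ne {R : Type*} [CommRing R] (A : Matrix V V R) (a : V) (t : R) :
    (A.submatrix (fun i : {x : V // x ≠ a} => (i : V))
      (fun i : {x : V // x ≠ a} => (i : V))).charpoly.eval t =
      (scalar V t - A).adjugate a a := by
  rw [eval_charpoly, adjugate_apply_self]
  congr 1
  ext i j
  simp [diagonal_apply, Subtype.ext_iff]

/-- Agreement of the diagonal entries of `A ^ ℓ` for `ℓ < |V|` forces agreement for all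
polynomials in `A`. -/
theorem aeval_apply_self_eq_of_pow {R : Type*} [CommRing R] [Nontrivial R] {A : Matrix V V R}
    {a b : V} (h : ∀ ℓ < Fintype.card V, (A ^ ℓ) a a = (A ^ ℓ) b b) (p : Polynomial R) :
    Polynomial.aeval A p a a = Polynomial.aeval A p b b := by
  have : Nonempty V := ⟨a⟩
  have hdeg : (p %ₘ A.charpoly).natDegree < Fintype.card V := by
    rw [← A.charpoly_natDegree_eq_dim]
    refine Polynomial.natDegree_modByMonic_lt p A.charpoly_monic fun h1 => ?_
    have := A.charpoly_natDegree_eq_dim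
    rw [h1, Polynomial.natDegree_one] at this
    exact Fintype.card_ne_zero this.symm
  rw [aeval_eq_aeval_mod_charpoly, Polynomial.aeval_eq_sum_range' hdeg, sum_apply, sum_apply]
  refine Finset.sum_congr rfl fun ℓ hℓ => ?_
  rw [smul_apply, smul_apply, h ℓ (Finset.mem_range.1 hℓ)]

end Matrix

/-- Non-cospectral vertices are distinguished by the number of closed walks of some length
below the number of vertices. -/
theorem IsSpectralDecomp.exists_pow_apply_self_ne {V : Type*} [Fintype V] [DecidableEq V]
    {A : Matrix V V ℝ} {m : ℕ} {θ : Fin m → ℝ} {E : Fin m → Matrix V V ℝ}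
    (h : IsSpectralDecomp A θ E) {a b : V}
    (hab : (A.submatrix (fun i : {x : V // x ≠ a} => (i : V))
          (fun i : {x : V // x ≠ a} => (i : V))).charpoly ≠
        (A.submatrix (fun i : {x : V // x ≠ b} => (i : V))
          (fun i : {x : V // x ≠ b} => (i : V))).charpoly) :
    ∃ ℓ < Fintype.card V, (A ^ ℓ) a a ≠ (A ^ ℓ) b b := by
  by_contra! hpow
  have hE : ∀ r, E r a a = E r b b := fun r => by
    obtain ⟨p, hp⟩ := h.exists_aeval_eq r
    rw [← hp, aeval_apply_self_eq_of_pow hpow]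
  refine hab (Polynomial.eq_of_infinite_eval_eq _ _
    ((Set.finite_range θ).infinite_compl.mono fun t ht => ?_))
  rw [Set.mem_ofPred_eq, eval_charpoly_submatrix_ne, eval_charpoly_submatrix_ne,
    h.adjugate_scalar_sub ht]
  simp [Matrix.sum_apply, hE]

theorem abs_pow_le_sum_pow_two_mul (t : ℝ) {n ℓ : ℕ} (hℓ : ℓ < n) (hℓ0 : ℓ ≠ 0) :
    |t| ^ ℓ ≤ ∑ k ∈ Finset.range n, t ^ (2 * k) := by
  have hpair : ∑ k ∈ {0, ℓ}, t ^ (2 * k) ≤ ∑ k ∈ Finset.range n, t ^ (2 * k) := by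
    refine Finset.sum_le_sum_of_subset_of_nonneg ?_ fun k _ _ => ?_
    · intro k hk
      simp only [Finset.mem_insert, Finset.mem_singleton] at hk
      exact Finset.mem_range.2 (by omega)
    · rw [pow_mul]; positivity
  rw [Finset.sum_pair hℓ0.symm] at hpair
  have hsq : t ^ (2 * ℓ) = (|t| ^ ℓ) ^ 2 := by
    rw [pow_mul, ← sq_abs, ← pow_mul, ← pow_mul, mul_comm]
  rw [hsq, mul_zero, pow_zero] at hpair
  nlinarith [sq_nonneg (|t| ^ ℓ - 1)]

/-- If `a` and `b` are not cospectral, then some diagonal entry difference of a spectral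
idempotent is at least `1 / trace(F Fᵀ)`, where `F` is the `m × n` Vandermonde-type matrix
with entries `θ_r ^ ℓ`. -/
theorem exists_idempotent_entry_gap_of_not_cospectral {V : Type*} [Fintype V]
    [DecidableEq V] (X : SimpleGraph V) [DecidableRel X.Adj] {m : ℕ} (θ : Fin m → ℝ)
    (E : Fin m → Matrix V V ℝ) (hdec : IsSpectralDecomp (X.adjMatrix ℝ) θ E) (a b : V)
    (hnotcos : ((X.adjMatrix ℝ).submatrix (fun i : {x : V // x ≠ a} => (i : V))
          (fun i : {x : V // x ≠ a} => (i : V))).charpoly ≠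
        ((X.adjMatrix ℝ).submatrix (fun i : {x : V // x ≠ b} => (i : V))
          (fun i : {x : V // x ≠ b} => (i : V))).charpoly) :
    ∃ r, 1 / (∑ s : Fin m, ∑ ℓ ∈ Finset.range (Fintype.card V), θ s ^ (2 * ℓ)) ≤
      |E r a a - E r b b| := by
  obtain ⟨ℓ, hℓ, hne⟩ := hdec.exists_pow_apply_self_ne hnotcos
  have hℓ0 : ℓ ≠ 0 := by
    rintro rfl
    simp at hne
  have hw : (X.adjMatrix ℝ ^ ℓ) a a - (X.adjMatrix ℝ ^ ℓ) b b =
      ∑ r, θ r ^ ℓ * (E r a a - E r b b) := by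
    simp [hdec.pow_eq_sum, Matrix.sum_apply, mul_sub]
  have hone : 1 ≤ |(X.adjMatrix ℝ ^ ℓ) a a - (X.adjMatrix ℝ ^ ℓ) b b| := by
    simp only [SimpleGraph.adjMatrix_pow_apply_eq_card_walk] at hne ⊢
    have hint := Int.one_le_abs (sub_ne_zero.2
      (Nat.cast_injective.ne (Nat.cast_injective.ne_iff.1 hne)))
    exact_mod_cast hint
  rw [hw] at hone
  have hm : (Finset.univ : Finset (Fin m)).Nonempty := by
    by_contra hempty
    rw [Finset.not_nonempty_iff_eq_empty.1 hempty] at hone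
    norm_num at hone
  set T : Fin m → ℝ := fun s => ∑ k ∈ Finset.range (Fintype.card V), θ s ^ (2 * k)
  have hT : ∀ s, 0 < T s := fun s =>
    Finset.sum_pos' (fun k _ => by rw [pow_mul]; positivity)
      ⟨0, Finset.mem_range.2 (by omega), by simp⟩
  by_contra! hlt
  refine absurd hone (not_le.2 ?_)
  calc |∑ r, θ r ^ ℓ * (E r a a - E r b b)|
      ≤ ∑ r, |θ r ^ ℓ * (E r a a - E r b b)| := Finset.abs_sum_le_sum_abs _ _
    _ ≤ ∑ r, T r * |E r a a - E r b b| := by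
        refine Finset.sum_le_sum fun r _ => ?_
        rw [abs_mul, abs_pow]
        exact mul_le_mul_of_nonneg_right (abs_pow_le_sum_pow_two_mul _ hℓ hℓ0) (abs_nonneg _)
    _ < ∑ r, T r * (1 / ∑ s, T s) :=
        Finset.sum_lt_sum_of_nonempty hm fun r _ => mul_lt_mul_of_pos_left (hlt r) (hT r)
    _ = 1 := by
        rw [← Finset.sum_mul, mul_one_div_cancel (Finset.sum_pos (fun s _ => hT s) hm).ne']
end
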